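/- Let E ⊇ F be fields, M a Lie E-algebra of maximal class, and L_1 an F-subspace of M_1 with E·L_1 = M_1; for i ≥ 2 set F_i := F⟨L_1, C_i⟩. Let U be a finite-dimensional F-subspace of M_i for some i ≥ 2. Then dim_F [U, L_1] ≥ dim_F U, and equality holds if and only if E_U contains F_i; in case of equality, E_U = E_{[U,L_1]}. -/

import Mathlib

set_option synthInstance.maxHeartbeats 1000000
set_option maxHeartbeats 1000000

section Defs

variable (R : Type*) [Field R] {M : Type*} [LieRing M] [Module R M]

/-- The graded pieces of the Lie subalgebra generated in degree 1 by `L1`: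
`gradedPieces R L1 1 = L1` and `gradedPieces R L1 (i+1) = [gradedPieces R L1 i, L1]`. -/
def gradedPieces (L1 : Submodule R M) : ℕ → Submodule R M
  | 0 => ⊥
  | 1 => L1
  | (n + 2) => Submodule.span R
      {z | ∃ x ∈ gradedPieces L1 (n + 1), ∃ y ∈ L1, z = ⁅x, y⁆}

/-- Iterated bracketing with `L1`, starting from `X0`:
`bracketIter R L1 X0 (j+1) = [bracketIter R L1 X0 j, L1]`. -/
def bracketIter (L1 X0 : Submodule R M) : ℕ → Submodule R M
  | 0 => X0
  | (j + 1) => Submodule.span R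
      {z | ∃ x ∈ bracketIter L1 X0 j, ∃ y ∈ L1, z = ⁅x, y⁆}

/-- `gr` is the grading of a graded Lie algebra `⊕_{i ≥ 1} gr i`, generated by its
first homogeneous component. -/
structure IsGradedLie (gr : ℕ → Submodule R M) : Prop where
  bot : gr 0 = ⊥
  internal : DirectSum.IsInternal gr
  bracket_mem : ∀ i j, ∀ x ∈ gr i, ∀ y ∈ gr j, ⁅x, y⁆ ∈ gr (i + j)
  gen : ∀ i, 1 ≤ i → gr (i + 1) =
    Submodule.span R {z | ∃ x ∈ gr i, ∃ y ∈ gr 1, z = ⁅x, y⁆}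

/-- `J` is a graded ideal of the graded Lie algebra with grading `gr`, presented via its
homogeneous components `J i = J ∩ gr i`. -/
def IsGradedIdealFam (gr J : ℕ → Submodule R M) : Prop :=
  (∀ i, J i ≤ gr i) ∧ ∀ i j, ∀ z ∈ J i, ∀ x ∈ gr j, ⁅z, x⁆ ∈ J (i + j)

/-- The graded Lie algebra with grading `gr` is ideally `r`-constrained: every nonzero
graded ideal `J` satisfies `L^i ⊇ J ⊇ L^(i+r)` for some `i`. -/
def IdeallyConstrained (gr : ℕ → Submodule R M) (r : ℕ) : Prop :=
  ∀ J : ℕ → Submodule R M, IsGradedIdealFam R gr J → (∃ i, J i ≠ ⊥) →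
    ∃ i, (∀ j, j < i → J j = ⊥) ∧ ∀ j, i + r ≤ j → J j = gr j

/-- The graded Lie algebra with grading `gr` is just infinite: every nonzero graded ideal
has finite codimension. -/
def JustInfinite (gr : ℕ → Submodule R M) : Prop :=
  ∀ J : ℕ → Submodule R M, IsGradedIdealFam R gr J → (∃ i, J i ≠ ⊥) →
    FiniteDimensional R (↥(⨆ i, gr i) ⧸ ((⨆ i, J i).comap (⨆ i, gr i).subtype))

end Defs

section MaxClass

variable (E : Type*) [Field E] {M : Type*} [LieRing M] [LieAlgebra E M]

/-- `gr` is the grading of a Lie algebra of maximal class over `E`. -/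
structure IsMaxClass (gr : ℕ → Submodule E M) : Prop where
  graded : IsGradedLie E gr
  dim_one : Module.finrank E ↥(gr 1) = 2
  dim_ge_two : ∀ i, 2 ≤ i → Module.finrank E ↥(gr i) = 1

/-- The `i`-th two-step centraliser `C_i = C_{M_1}(M_i)`. -/
def twoStepCent (gr : ℕ → Submodule E M) (i : ℕ) : Submodule E M :=
  gr 1 ⊓ ⨅ m : ↥(gr i), LinearMap.ker (LieAlgebra.ad E M (m : M))

end MaxClass

/-- The set `E_s` of scalars stabilising a subset `s` of an `E`-vector space. -/
def scalarStab (E : Type*) [Field E] {M : Type*} [AddCommGroup M] [Module E M]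
    (s : Set M) : Set E := {α | ∀ v ∈ s, α • v ∈ s}


/-- A linear map injective on `U` preserves the rank of `U`. -/
theorem rank_map_eq_of_forall_eq_zero {F M : Type*} [Field F] [AddCommGroup M] [Module F M]
    (T : M →ₗ[F] M) (U : Submodule F M) (hT : ∀ u ∈ U, T u = 0 → u = 0) :
    Module.rank F ↥(U.map T) = Module.rank F ↥U := by
  have hinj : Function.Injective (T.domRestrict U) := by
    rw [injective_iff_map_eq_zero]
    rintro ⟨u, hu⟩ h
    exact Subtype.ext (hT u hu h)
  have e := (LinearEquiv.ofInjective _ hinj).rank_eq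
  rw [LinearMap.range_domRestrict] at e
  exact e.symm

/-- If `T` is injective on a finite-dimensional `U` and maps `U` into `B`, then `U` and `B` have
the same rank precisely when `T` maps `U` onto `B`. -/
theorem rank_eq_iff_map_eq {F M : Type*} [Field F] [AddCommGroup M] [Module F M]
    (T : M →ₗ[F] M) (U B : Submodule F M) [FiniteDimensional F U]
    (hT : ∀ u ∈ U, T u = 0 → u = 0) (hB : U.map T ≤ B) :
    Module.rank F ↥U = Module.rank F ↥B ↔ U.map T = B := by
  have hr := rank_map_eq_of_forall_eq_zero T U hT
  refine ⟨fun h => ?_, fun h => by rw [← h, hr]⟩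
  have hfin : FiniteDimensional F B := by
    rw [FiniteDimensional, ← Module.rank_lt_aleph0_iff, ← h]
    exact Module.rank_lt_aleph0 F U
  refine Submodule.eq_of_le_of_finrank_eq hB ?_
  rw [Module.finrank, Module.finrank, hr, h]

/-- The scalars stabilising a finite-dimensional subspace form an intermediate field. -/
theorem adjoin_subset_scalarStab_iff {F E M : Type*} [Field F] [Field E] [Algebra F E]
    [AddCommGroup M] [Module E M] [Module F M] [IsScalarTower F E M]
    (U : Submodule F M) [FiniteDimensional F U] (S : Set E) :
    (IntermediateField.adjoin F S : Set E) ⊆ scalarStab E (U : Set M) ↔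
      S ⊆ scalarStab E (U : Set M) := by
  refine ⟨(IntermediateField.subset_adjoin F S).trans, fun h x hx => ?_⟩
  induction hx using IntermediateField.adjoin_induction with
  | mem x hx => exact h hx
  | algebraMap x =>
    intro v hv
    rw [algebraMap_smul]
    exact U.smul_mem x hv
  | add x y _ _ hx hy =>
    intro v hv
    rw [add_smul]
    exact U.add_mem (hx v hv) (hy v hv)
  | mul x y _ _ hx hy =>
    intro v hv
    rw [mul_smul]
    exact hx _ (hy v hv)
  | inv x _ hx =>
    intro v hv
    rcases eq_or_ne x 0 with rfl | h0
    · simp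
    · have hle : U.map ((LinearMap.lsmul E M x).restrictScalars F) ≤ U := by
        rintro _ ⟨u, hu, rfl⟩
        exact hx u hu
      have heq := (rank_eq_iff_map_eq _ U U
        (fun u _ hu => (smul_eq_zero.mp hu).resolve_left h0) hle).mp rfl
      obtain ⟨u, hu, rfl⟩ : v ∈ U.map ((LinearMap.lsmul E M x).restrictScalars F) := by
        rwa [heq]
      simpa [inv_smul_smul₀ h0] using hu

theorem mem_twoStepCent {E M : Type*} [Field E] [LieRing M] [LieAlgebra E M]
    {gr : ℕ → Submodule E M} {i : ℕ} {v : M} :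
    v ∈ twoStepCent E gr i ↔ v ∈ gr 1 ∧ ∀ m ∈ gr i, ⁅m, v⁆ = 0 := by
  simp [twoStepCent, Submodule.mem_iInf]

/-- An element of `M_1` outside `C_i` acts injectively on `M_i`. -/
theorem IsMaxClass.eq_zero_of_lie_eq_zero {E M : Type*} [Field E] [LieRing M] [LieAlgebra E M]
    {gr : ℕ → Submodule E M} (hM : IsMaxClass E gr) {i : ℕ} (hi : 2 ≤ i) {v : M}
    (hv : v ∈ gr 1) (hvC : v ∉ twoStepCent E gr i) {u : M} (hu : u ∈ gr i) (h : ⁅u, v⁆ = 0) :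
    u = 0 := by
  by_contra hu0
  refine hvC (mem_twoStepCent.mpr ⟨hv, fun m hm => ?_⟩)
  obtain ⟨c, hc⟩ := (finrank_eq_one_iff_of_nonzero' (⟨u, hu⟩ : gr i)
    (fun h0 => hu0 (congrArg Subtype.val h0))).mp (hM.dim_ge_two i hi) ⟨m, hm⟩
  have hc' : c • u = m := congrArg Subtype.val hc
  rw [← hc', smul_lie, h, smul_zero]

/-- A generating subset of `M_1` is not contained in a two-step centraliser. -/
theorem IsMaxClass.exists_notMem_twoStepCent {E M : Type*} [Field E] [LieRing M]
    [LieAlgebra E M] {gr : ℕ → Submodule E M} (hM : IsMaxClass E gr) {i : ℕ} (hi : 2 ≤ i)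
    {S : Set M} (hS : Submodule.span E S = gr 1) : ∃ v ∈ S, v ∉ twoStepCent E gr i := by
  by_contra! hC
  have hle : gr 1 ≤ twoStepCent E gr i := hS ▸ Submodule.span_le.mpr hC
  have hbot : gr (i + 1) = ⊥ := by
    rw [hM.graded.gen i (by omega), Submodule.span_eq_bot]
    rintro _ ⟨x, hx, y, hy, rfl⟩
    exact (mem_twoStepCent.mp (hle hy)).2 x hx
  have hdim := hM.dim_ge_two (i + 1) (by omega)
  rw [hbot, finrank_bot] at hdim
  exact zero_ne_one hdim

theorem covering (F E : Type*) [Field F] [Field E] [Algebra F E]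
    (M : Type*) [LieRing M] [LieAlgebra E M] [Module F M] [IsScalarTower F E M]
    (Mgr : ℕ → Submodule E M) (hM : IsMaxClass E Mgr)
    (L₁ : Submodule F M) (hL₁ : (L₁ : Set M) ⊆ (Mgr 1 : Set M))
    (hspan : Submodule.span E (L₁ : Set M) = Mgr 1)
    (i : ℕ) (hi : 2 ≤ i)
    (U : Submodule F M) (hUi : (U : Set M) ⊆ (Mgr i : Set M))
    (hUfin : FiniteDimensional F ↥U) :
    Module.rank F ↥U ≤ Module.rank F ↥(bracketIter F L₁ U 1) ∧
    ∀ φ : M →ₗ[E] E,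
      (∀ v ∈ Mgr 1, (φ v = 0 ↔ v ∈ twoStepCent E Mgr i)) →
      (1 : E) ∈ ⇑φ '' (L₁ : Set M) →
      ((Module.rank F ↥U = Module.rank F ↥(bracketIter F L₁ U 1) ↔
          (IntermediateField.adjoin F (⇑φ '' (L₁ : Set M)) : Set E) ⊆
            scalarStab E (U : Set M)) ∧
        (Module.rank F ↥U = Module.rank F ↥(bracketIter F L₁ U 1) →
          scalarStab E (U : Set M) = scalarStab E ((bracketIter F L₁ U 1 : Submodule F M) : Set M))) := by
  let T : M → M →ₗ[F] M := fun l => (-(LieAlgebra.ad E M l)).restrictScalars F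
  have hT : ∀ l u, T l u = ⁅u, l⁆ := fun l u => by simp [T]
  have hTB : ∀ l ∈ L₁, U.map (T l) ≤ bracketIter F L₁ U 1 := by
    rintro l hl _ ⟨u, hu, rfl⟩
    exact Submodule.subset_span ⟨u, hu, l, hl, hT l u⟩
  have hinj : ∀ l ∈ L₁, l ∉ twoStepCent E Mgr i → ∀ u ∈ Mgr i, T l u = 0 → u = 0 :=
    fun l hl hlC u hu h =>
      hM.eq_zero_of_lie_eq_zero hi (hL₁ hl) hlC hu ((hT l u).symm.trans h)
  refine ⟨?_, ?_⟩
  · obtain ⟨l, hl, hlC⟩ := hM.exists_notMem_twoStepCent hi hspan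
    rw [← rank_map_eq_of_forall_eq_zero (T l) U fun u hu => hinj l hl hlC u (hUi hu)]
    exact Submodule.rank_mono (hTB l hl)
  · rintro φ hφ ⟨l, hl, hφl⟩
    have hlC : l ∉ twoStepCent E Mgr i := fun h =>
      one_ne_zero (hφl.symm.trans ((hφ l (hL₁ hl)).mpr h))
    have hsmul : ∀ (c : E) (u : M), T l (c • u) = c • T l u := fun c u => by
      rw [hT, hT, smul_lie]
    have hlie : ∀ u ∈ Mgr i, ∀ v ∈ L₁, ⁅u, v⁆ = T l (φ v • u) := by
      intro u hu v hv
      have hmem : v - φ v • l ∈ Mgr 1 :=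
        Submodule.sub_mem _ (hL₁ hv) (Submodule.smul_mem _ _ (hL₁ hl))
      have hC := (hφ _ hmem).mp (by simp [hφl])
      have h0 := (mem_twoStepCent.mp hC).2 u hu
      rw [lie_sub, lie_smul, sub_eq_zero] at h0
      rw [hsmul, hT, h0]
    have hmem_of_map : ∀ u ∈ Mgr i, T l u ∈ U.map (T l) → u ∈ U := by
      rintro u hu ⟨w, hw, hwu⟩
      have h0 : u - w = 0 := hinj l hl hlC _ (Submodule.sub_mem _ hu (hUi hw)) (by
        rw [map_sub, hwu, sub_self])
      rwa [sub_eq_zero.mp h0]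
    have hrank := rank_eq_iff_map_eq (T l) U (bracketIter F L₁ U 1)
      (fun u hu => hinj l hl hlC u (hUi hu)) (hTB l hl)
    rw [adjoin_subset_scalarStab_iff, hrank]
    refine ⟨⟨?_, fun h => ?_⟩, fun h => ?_⟩
    · rintro h _ ⟨v, hv, rfl⟩ u hu
      refine hmem_of_map _ (Submodule.smul_mem _ _ (hUi hu)) ?_
      rw [h, ← hlie u (hUi hu) v hv]
      exact Submodule.subset_span ⟨u, hu, v, hv, rfl⟩
    · refine le_antisymm (hTB l hl) (Submodule.span_le.mpr ?_)
      rintro _ ⟨u, hu, v, hv, rfl⟩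
      exact ⟨φ v • u, h ⟨v, hv, rfl⟩ u hu, (hlie u (hUi hu) v hv).symm⟩
    · rw [← h]
      ext c
      constructor
      · rintro hc _ ⟨u, hu, rfl⟩
        exact ⟨c • u, hc u hu, hsmul c u⟩
      · intro hc u hu
        refine hmem_of_map _ (Submodule.smul_mem _ _ (hUi hu)) ?_
        rw [hsmul]
        exact hc _ ⟨u, hu, rfl⟩
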